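/- arXiv:1010.2188 — 2 statements merged into one kernel-verified Lean document; each statement's English description precedes it below -/
import Mathlib

section
/- Let V be a finite-dimensional vector space over a field, N a nilpotent endomorphism, and M_• its monodromy filtration. For integers p ≥ 1, q ≥ 0 define Gr^q Gr_p V = (ker N^p ∩ im N^q) / ((ker N^{p−1} ∩ im N^q) + (ker N^p ∩ im N^{q+1})), with the conventions N^0 = id and im N^q = V for q = 0. Then for every integer r there is an isomorphism Gr^M_r V ≅ ⊕_{p−q−1=r, p≥1, q≥0} Gr^q Gr_p V. -/
/-- `M` is a monodromy filtration for the nilpotent endomorphism `N`. -/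
def IsMonodromyFiltration {K V : Type*} [Field K] [AddCommGroup V] [Module K V]
    (N : V →ₗ[K] V) (M : ℤ → Submodule K V) : Prop :=
  Monotone M ∧
  (∃ a : ℤ, ∀ r ≤ a, M r = ⊥) ∧
  (∃ b : ℤ, ∀ r : ℤ, b ≤ r → M r = ⊤) ∧
  (∀ r : ℤ, Submodule.map N (M r) ≤ M (r - 2)) ∧
  (∀ r : ℕ,
    LinearMap.ker ((M (-(r : ℤ) - 1)).mkQ ∘ₗ (N ^ r) ∘ₗ (M (r : ℤ)).subtype) =
      Submodule.comap (M (r : ℤ)).subtype (M ((r : ℤ) - 1)) ∧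
    LinearMap.range ((M (-(r : ℤ) - 1)).mkQ ∘ₗ (N ^ r) ∘ₗ (M (r : ℤ)).subtype) =
      Submodule.map (M (-(r : ℤ) - 1)).mkQ (M (-(r : ℤ))))

open Module

section LinearAlgebra

variable {K V W : Type*} [Field K] [AddCommGroup V] [Module K V] [AddCommGroup W] [Module K W]

theorem Submodule.finrank_map_add_finrank_inf_ker [FiniteDimensional K V]
    (f : V →ₗ[K] W) (S : Submodule K V) :
    finrank K (S.map f) + finrank K (S ⊓ LinearMap.ker f : Submodule K V) = finrank K S := by
  have h := LinearMap.finrank_range_add_finrank_ker (f ∘ₗ S.subtype)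
  rw [LinearMap.range_comp, Submodule.range_subtype, LinearMap.ker_comp] at h
  rw [← h, ← Submodule.map_comap_subtype, Submodule.finrank_map_subtype_eq]

theorem Submodule.finrank_comap_subtype_of_le {S T : Submodule K V} (h : S ≤ T) :
    finrank K (S.comap T.subtype) = finrank K S :=
  (Submodule.comapSubtypeEquivOfLe h).finrank_eq

theorem Submodule.finrank_quotient_comap_subtype [FiniteDimensional K V] {S T : Submodule K V}
    (h : S ≤ T) :
    (finrank K (T ⧸ S.comap T.subtype) : ℤ) = finrank K T - finrank K S := by
  have := Submodule.finrank_quotient_add_finrank (S.comap T.subtype)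
  rw [Submodule.finrank_comap_subtype_of_le h] at this
  omega

theorem LinearMap.map_pow_ker_pow_add (N : V →ₗ[K] V) (p q : ℕ) :
    (LinearMap.ker (N ^ (p + q))).map (N ^ q) = LinearMap.ker (N ^ p) ⊓ LinearMap.range (N ^ q) := by
  rw [pow_add, Module.End.mul_eq_comp, LinearMap.ker_comp, Submodule.map_comap_eq, inf_comm]

theorem LinearMap.ker_pow_mono (N : V →ₗ[K] V) {m n : ℕ} (h : m ≤ n) :
    LinearMap.ker (N ^ m) ≤ LinearMap.ker (N ^ n) := by
  intro x hx
  rw [LinearMap.mem_ker] at hx ⊢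
  rw [← Nat.sub_add_cancel h, pow_add, Module.End.mul_apply, hx, map_zero]

theorem LinearMap.range_pow_anti (N : V →ₗ[K] V) {m n : ℕ} (h : m ≤ n) :
    LinearMap.range (N ^ n) ≤ LinearMap.range (N ^ m) := by
  rintro _ ⟨x, rfl⟩
  exact ⟨(N ^ (n - m)) x, by rw [← Module.End.mul_apply, ← pow_add, Nat.add_sub_cancel' h]⟩

theorem LinearMap.finrank_ker_pow_inf_range_pow [FiniteDimensional K V] (N : V →ₗ[K] V)
    (p q : ℕ) :
    (finrank K (LinearMap.ker (N ^ p) ⊓ LinearMap.range (N ^ q) : Submodule K V) : ℤ) =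
      finrank K (LinearMap.ker (N ^ (p + q))) - finrank K (LinearMap.ker (N ^ q)) := by
  have h := Submodule.finrank_map_add_finrank_inf_ker (N ^ q) (LinearMap.ker (N ^ (p + q)))
  rw [LinearMap.map_pow_ker_pow_add,
    inf_eq_right.2 (LinearMap.ker_pow_mono N (Nat.le_add_left q p))] at h
  omega

/-- The dimension of `Gr^q Gr_{p+1} V` is the number of Jordan blocks of size `p + 1 + q`. -/
theorem LinearMap.finrank_ker_range_bigraded [FiniteDimensional K V] (N : V →ₗ[K] V) (p q : ℕ) :
    (finrank K (↥(LinearMap.ker (N ^ (p + 1)) ⊓ LinearMap.range (N ^ q)) ⧸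
      Submodule.comap (LinearMap.ker (N ^ (p + 1)) ⊓ LinearMap.range (N ^ q)).subtype
        ((LinearMap.ker (N ^ p) ⊓ LinearMap.range (N ^ q)) ⊔
          (LinearMap.ker (N ^ (p + 1)) ⊓ LinearMap.range (N ^ (q + 1))))) : ℤ) =
      2 * finrank K (LinearMap.ker (N ^ (p + q + 1))) - finrank K (LinearMap.ker (N ^ (p + q))) -
        finrank K (LinearMap.ker (N ^ (p + q + 2))) := by
  have hk := LinearMap.ker_pow_mono N (Nat.le_add_right p 1)
  have hr := LinearMap.range_pow_anti N (Nat.le_add_right q 1)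
  rw [Submodule.finrank_quotient_comap_subtype
    (sup_le (inf_le_inf_right _ hk) (inf_le_inf_left _ hr))]
  have hs := Submodule.finrank_sup_add_finrank_inf_eq
    (LinearMap.ker (N ^ p) ⊓ LinearMap.range (N ^ q))
    (LinearMap.ker (N ^ (p + 1)) ⊓ LinearMap.range (N ^ (q + 1)))
  rw [inf_inf_inf_comm, inf_eq_left.2 hk, inf_eq_right.2 hr] at hs
  have h₁ := LinearMap.finrank_ker_pow_inf_range_pow N (p + 1) q
  have h₂ := LinearMap.finrank_ker_pow_inf_range_pow N p q
  have h₃ := LinearMap.finrank_ker_pow_inf_range_pow N (p + 1) (q + 1)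
  have h₄ := LinearMap.finrank_ker_pow_inf_range_pow N p (q + 1)
  rw [show p + 1 + q = p + q + 1 by ring] at h₁
  rw [show p + 1 + (q + 1) = p + q + 2 by ring] at h₃
  rw [show p + (q + 1) = p + q + 1 by ring] at h₄
  omega

open DirectSum in
/-- A direct sum whose summands vanish outside the range of an injective map `f` is the product of
the summands indexed by `f`. -/
theorem DirectSum.nonempty_linearEquiv_pi_of_subsingleton {ι κ : Type*} [Fintype κ]
    (W : ι → Type*) [∀ i, AddCommGroup (W i)] [∀ i, Module K (W i)]
    (f : κ → ι) (hf : Function.Injective f)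
    (hW : ∀ i ∉ Set.range f, Subsingleton (W i)) :
    Nonempty ((⨁ i, W i) ≃ₗ[K] (∀ j, W (f j))) := by
  classical
  let φ : (⨁ i, W i) →ₗ[K] (∀ j, W (f j)) :=
    LinearMap.pi fun j => DirectSum.component K ι W (f j)
  refine ⟨LinearEquiv.ofBijective φ ⟨?_, ?_⟩⟩
  · intro x y hxy
    refine DFinsupp.ext fun i => ?_
    by_cases hi : i ∈ Set.range f
    · obtain ⟨j, rfl⟩ := hi
      exact congrFun hxy j
    · have := hW i hi
      exact Subsingleton.elim _ _
  · intro y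
    refine ⟨∑ j, DirectSum.lof K ι W (f j) (y j), ?_⟩
    funext j
    rw [map_sum, Finset.sum_apply, Finset.sum_eq_single j]
    · exact DirectSum.component.lof_self K (f j) (y j)
    · intro k _ hk
      exact DFinsupp.single_eq_of_ne (fun h => hk (hf h).symm)
    · simp

end LinearAlgebra

namespace IsMonodromyFiltration

variable {K V : Type*} [Field K] [AddCommGroup V] [Module K V]
  {N : V →ₗ[K] V} {M : ℤ → Submodule K V}

theorem pow_apply_mem (hM : IsMonodromyFiltration N M) (n : ℕ) {r : ℤ} {x : V} (hx : x ∈ M r) :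
    (N ^ n) x ∈ M (r - 2 * n) := by
  induction n with
  | zero => simpa using hx
  | succ n ih =>
    rw [pow_succ', Module.End.mul_apply]
    have := hM.2.2.2.1 _ (Submodule.mem_map_of_mem ih)
    rwa [show r - 2 * (n : ℤ) - 2 = r - 2 * ((n + 1 : ℕ) : ℤ) by push_cast; ring] at this

theorem mem_sub_one_of_pow_apply_eq_zero (hM : IsMonodromyFiltration N M) {n r : ℕ} (h : n ≤ r)
    {x : V} (hx : x ∈ M r) (hx0 : (N ^ n) x = 0) : x ∈ M ((r : ℤ) - 1) := by
  have hr : (N ^ r) x = 0 := LinearMap.ker_pow_mono N h hx0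
  have : (⟨x, hx⟩ : M r) ∈ LinearMap.ker
      ((M (-(r : ℤ) - 1)).mkQ ∘ₗ (N ^ r) ∘ₗ (M (r : ℤ)).subtype) := by
    simp [hr]
  rw [(hM.2.2.2.2 r).1] at this
  exact this

theorem ker_pow_le (hM : IsMonodromyFiltration N M) (n : ℕ) :
    LinearMap.ker (N ^ n) ≤ M ((n : ℤ) - 1) := by
  intro x hx
  obtain ⟨b, hb⟩ := hM.2.2.1
  have key : ∀ j : ℕ, x ∈ M ((n : ℤ) - 1 + j) → x ∈ M ((n : ℤ) - 1) := by
    intro j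
    induction j with
    | zero => simp
    | succ j ih =>
      intro h
      apply ih
      have := hM.mem_sub_one_of_pow_apply_eq_zero (n := n) (r := n + j) (by omega)
        (by convert h using 2; push_cast; ring) hx
      convert this using 2
      push_cast; ring
  apply key (b - n + 1).toNat
  rw [hb _ (by omega)]
  trivial

theorem le_map_pow (hM : IsMonodromyFiltration N M) {n s : ℕ} (h : n ≤ s) :
    M (-(s : ℤ)) ≤ (M (2 * n - s : ℤ)).map (N ^ n) := by
  obtain ⟨a, ha⟩ := hM.2.1
  have key : ∀ j s : ℕ, n ≤ s → -(s : ℤ) ≤ a + j →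
      M (-(s : ℤ)) ≤ (M (2 * n - s : ℤ)).map (N ^ n) := by
    intro j
    induction j with
    | zero =>
      intro s _ hs
      rw [ha _ (by simpa using hs)]
      exact bot_le
    | succ j ih =>
      intro s hns hs x hx
      have hx' : (M (-(s : ℤ) - 1)).mkQ x ∈ LinearMap.range
          ((M (-(s : ℤ) - 1)).mkQ ∘ₗ (N ^ s) ∘ₗ (M (s : ℤ)).subtype) := by
        rw [(hM.2.2.2.2 s).2]
        exact Submodule.mem_map_of_mem hx
      obtain ⟨⟨y, hy⟩, hxy⟩ := hx'
      have hd : x - (N ^ s) y ∈ M (-(s : ℤ) - 1) := (Submodule.Quotient.eq _).1 hxy.symm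
      have hlow := ih (s + 1) (by omega) (by push_cast at hs ⊢; omega)
      rw [show -((s + 1 : ℕ) : ℤ) = -(s : ℤ) - 1 by push_cast; ring] at hlow
      have h₁ := Submodule.map_mono (f := N ^ n)
        (hM.1 (show (2 * n - ((s + 1 : ℕ) : ℤ) : ℤ) ≤ 2 * n - s by push_cast; omega)) (hlow hd)
      have h₂ : (N ^ s) y ∈ (M (2 * n - s : ℤ)).map (N ^ n) := by
        refine ⟨(N ^ (s - n)) y, ?_, ?_⟩
        · have := hM.pow_apply_mem (s - n) hy
          rwa [show (s : ℤ) - 2 * ((s - n : ℕ) : ℤ) = 2 * n - s by omega] at this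
        · rw [← Module.End.mul_apply, ← pow_add, Nat.add_sub_cancel' hns]
      simpa using add_mem h₁ h₂
  exact key (-(s : ℤ) - a).toNat s h (by omega)

theorem map_pow_eq (hM : IsMonodromyFiltration N M) (n : ℕ) :
    (M ((n : ℤ) - 1)).map (N ^ n) = M (-(n : ℤ) - 1) := by
  apply le_antisymm
  · rintro _ ⟨x, hx, rfl⟩
    have := hM.pow_apply_mem n hx
    rwa [show (n : ℤ) - 1 - 2 * n = -n - 1 by ring] at this
  · have := hM.le_map_pow (Nat.le_succ n)
    rwa [show -((n.succ : ℕ) : ℤ) = -(n : ℤ) - 1 by push_cast; ring,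
      show 2 * n - ((n.succ : ℕ) : ℤ) = (n : ℤ) - 1 by push_cast; ring] at this

variable [FiniteDimensional K V]

theorem finrank_ker_pow (hM : IsMonodromyFiltration N M) (n : ℕ) :
    (finrank K (LinearMap.ker (N ^ n)) : ℤ) =
      finrank K (M ((n : ℤ) - 1)) - finrank K (M (-(n : ℤ) - 1)) := by
  have h := Submodule.finrank_map_add_finrank_inf_ker (N ^ n) (M ((n : ℤ) - 1))
  rw [hM.map_pow_eq, inf_eq_right.2 (hM.ker_pow_le n)] at h
  omega

theorem finrank_symm (hM : IsMonodromyFiltration N M) (r : ℕ) :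
    (finrank K (M (r : ℤ)) : ℤ) - finrank K (M ((r : ℤ) - 1)) =
      finrank K (M (-(r : ℤ))) - finrank K (M (-(r : ℤ) - 1)) := by
  have h₁ := LinearMap.finrank_range_add_finrank_ker
    ((M (-(r : ℤ) - 1)).mkQ ∘ₗ (N ^ r) ∘ₗ (M (r : ℤ)).subtype)
  rw [(hM.2.2.2.2 r).1, (hM.2.2.2.2 r).2,
    Submodule.finrank_comap_subtype_of_le (hM.1 (by omega))] at h₁
  have h₂ := Submodule.finrank_map_add_finrank_inf_ker (M (-(r : ℤ) - 1)).mkQ (M (-(r : ℤ)))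
  rw [Submodule.ker_mkQ, inf_eq_right.2 (hM.1 (by omega))] at h₂
  omega

theorem finrank_graded_natAbs (hM : IsMonodromyFiltration N M) (r : ℤ) :
    (finrank K (M r) : ℤ) - finrank K (M (r - 1)) =
      finrank K (M (r.natAbs : ℤ)) - finrank K (M ((r.natAbs : ℤ) - 1)) := by
  obtain h | h := Int.natAbs_eq r
  · rw [← h]
  · rw [hM.finrank_symm, ← h]

/-- The dimension of the primitive part of `Gr^M_n V`, in terms of kernels of powers of `N`. -/
theorem finrank_primitive (hM : IsMonodromyFiltration N M) (n : ℕ) :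
    (2 * finrank K (LinearMap.ker (N ^ (n + 1))) - finrank K (LinearMap.ker (N ^ n)) -
        finrank K (LinearMap.ker (N ^ (n + 2))) : ℤ) =
      (finrank K (M (n : ℤ)) - finrank K (M ((n : ℤ) - 1))) -
        (finrank K (M ((n : ℤ) + 2)) - finrank K (M ((n : ℤ) + 1))) := by
  have k₀ := hM.finrank_ker_pow n
  have k₁ := hM.finrank_ker_pow (n + 1)
  have k₂ := hM.finrank_ker_pow (n + 2)
  have s₁ := hM.finrank_symm (n + 1)
  have s₂ := hM.finrank_symm (n + 2)
  rw [show ((n + 1 : ℕ) : ℤ) - 1 = n by push_cast; ring,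
    show -((n + 1 : ℕ) : ℤ) - 1 = -n - 2 by push_cast; ring] at k₁ s₁
  rw [show ((n + 2 : ℕ) : ℤ) - 1 = n + 1 by push_cast; ring,
    show -((n + 2 : ℕ) : ℤ) - 1 = -n - 3 by push_cast; ring] at k₂ s₂
  rw [show ((n + 1 : ℕ) : ℤ) = n + 1 by push_cast; ring,
    show -((n : ℤ) + 1) = -n - 1 by ring] at s₁
  rw [show ((n + 2 : ℕ) : ℤ) = n + 2 by push_cast; ring,
    show -((n : ℤ) + 2) = -n - 2 by ring] at s₂
  linarith

end IsMonodromyFiltration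

open DirectSum in
/-- The graded pieces of the monodromy filtration decompose as
`Gr^M_r V ≅ ⊕_{p−q−1=r, p≥1, q≥0} Gr^q Gr_p V`, where
`Gr^q Gr_p V = (ker N^p ∩ im N^q)/((ker N^{p−1} ∩ im N^q) + (ker N^p ∩ im N^{q+1}))`. -/
theorem stmt_11 (K V : Type*) [Field K] [AddCommGroup V] [Module K V]
    [FiniteDimensional K V] (N : V →ₗ[K] V) (hN : IsNilpotent N)
    (M : ℤ → Submodule K V) (hM : IsMonodromyFiltration N M) :
    ∀ r : ℤ, Nonempty (
      ((M r) ⧸ Submodule.comap (M r).subtype (M (r - 1))) ≃ₗ[K]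
      ⨁ pq : {pq : ℕ × ℕ // 1 ≤ pq.1 ∧ (pq.1 : ℤ) - (pq.2 : ℤ) - 1 = r},
        (↥(LinearMap.ker (N ^ (pq.1.1 : ℕ)) ⊓ LinearMap.range (N ^ (pq.1.2 : ℕ))) ⧸
          Submodule.comap
            (LinearMap.ker (N ^ (pq.1.1 : ℕ)) ⊓ LinearMap.range (N ^ (pq.1.2 : ℕ))).subtype
            ((LinearMap.ker (N ^ (pq.1.1 - 1 : ℕ)) ⊓ LinearMap.range (N ^ (pq.1.2 : ℕ))) ⊔
             (LinearMap.ker (N ^ (pq.1.1 : ℕ)) ⊓ LinearMap.range (N ^ (pq.1.2 + 1 : ℕ)))))) := by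
  intro r
  obtain ⟨b, hb⟩ := hM.2.2.1
  obtain ⟨c, hc⟩ := hN
  set L : ℕ := b.toNat + c + 1 with hL
  let f : Fin L → {pq : ℕ × ℕ // 1 ≤ pq.1 ∧ (pq.1 : ℤ) - (pq.2 : ℤ) - 1 = r} := fun j =>
    ⟨(r.toNat + j + 1, (-r).toNat + j), by
      constructor
      · exact Nat.le_add_left _ _
      · push_cast
        omega⟩
  have hf : Function.Injective f := by
    intro i j hij
    have := congrArg (fun x => x.1.1) hij
    simp only [f] at this
    exact Fin.ext (by omega)
  obtain ⟨e⟩ := DirectSum.nonempty_linearEquiv_pi_of_subsingleton (K := K)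
    (fun pq : {pq : ℕ × ℕ // 1 ≤ pq.1 ∧ (pq.1 : ℤ) - (pq.2 : ℤ) - 1 = r} =>
      (↥(LinearMap.ker (N ^ (pq.1.1 : ℕ)) ⊓ LinearMap.range (N ^ (pq.1.2 : ℕ))) ⧸
          Submodule.comap
            (LinearMap.ker (N ^ (pq.1.1 : ℕ)) ⊓ LinearMap.range (N ^ (pq.1.2 : ℕ))).subtype
            ((LinearMap.ker (N ^ (pq.1.1 - 1 : ℕ)) ⊓ LinearMap.range (N ^ (pq.1.2 : ℕ))) ⊔
             (LinearMap.ker (N ^ (pq.1.1 : ℕ)) ⊓ LinearMap.range (N ^ (pq.1.2 + 1 : ℕ))))))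
    f hf (by
      rintro ⟨⟨p, q⟩, hp, hpq⟩ hi
      dsimp only at hp hpq ⊢
      have hq : L ≤ q := by
        by_contra hlt
        refine hi ⟨⟨q - (-r).toNat, by omega⟩, ?_⟩
        apply Subtype.ext
        apply Prod.ext
        · simp only [f]
          omega
        · simp only [f]
          omega
      have hNq : N ^ q = 0 := pow_eq_zero_of_le (by omega) hc
      rw [Submodule.Quotient.subsingleton_iff, Submodule.comap_subtype_eq_top, hNq]
      simp)
  refine ⟨LinearEquiv.ofFinrankEq _ _ ?_ ≪≫ₗ e.symm⟩
  rw [Module.finrank_pi_fintype]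
  zify
  rw [Submodule.finrank_quotient_comap_subtype (hM.1 (by omega)), hM.finrank_graded_natAbs]
  let G : ℕ → ℤ := fun j => finrank K (M (r.natAbs + 2 * j : ℤ)) -
    finrank K (M (r.natAbs + 2 * j - 1 : ℤ))
  have hterm : ∀ j : Fin L, _ = G j - G (j + 1) := fun j =>
    (LinearMap.finrank_ker_range_bigraded N (r.toNat + j) ((-r).toNat + j)).trans <| by
      rw [hM.finrank_primitive]
      have : ((r.toNat + j + ((-r).toNat + j) : ℕ) : ℤ) = r.natAbs + 2 * (j : ℕ) := by omega
      simp only [G]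
      rw [this,
        show (r.natAbs + 2 * ((j + 1 : ℕ) : ℤ) : ℤ) = r.natAbs + 2 * (j : ℕ) + 2 by push_cast; ring,
        show (r.natAbs + 2 * (j : ℕ) + 2 - 1 : ℤ) = r.natAbs + 2 * (j : ℕ) + 1 by ring]
  refine Eq.trans ?_ (Finset.sum_congr rfl fun j _ => hterm j).symm
  rw [Fin.sum_univ_eq_sum_range (fun j => G j - G (j + 1)) L, Finset.sum_range_sub']
  have hGL : G L = 0 := by
    simp only [G]
    rw [hb _ (by omega), hb _ (by omega), sub_self]
  rw [hGL, sub_zero]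
  simp only [G]
  rw [show (r.natAbs + 2 * ((0 : ℕ) : ℤ) : ℤ) = r.natAbs by simp]
end

section
/- Let F be a field of characteristic zero, V and W finite-dimensional F-vector spaces, and N_1, N_2 nilpotent endomorphisms of V and W respectively. Let N = N_1 ⊗ id + id ⊗ N_2 on V ⊗ W, which is nilpotent. Then the monodromy filtration of N is the convolution of the monodromy filtrations of N_1 and N_2: for every r, M_r(V ⊗ W, N) = Σ_{i+j=r} M_i(V, N_1) ⊗ M_j(W, N_2). -/
open TensorProduct

section Uniqueness

variable {K V : Type*} [Field K] [AddCommGroup V] [Module K V] {N : V →ₗ[K] V}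

lemma isMonodromyFiltration_ker_iff {M : ℤ → Submodule K V} (hM : Monotone M) (r : ℕ) :
    LinearMap.ker ((M (-(r : ℤ) - 1)).mkQ ∘ₗ (N ^ r) ∘ₗ (M (r : ℤ)).subtype) =
      Submodule.comap (M (r : ℤ)).subtype (M ((r : ℤ) - 1)) ↔
    M ((r : ℤ) - 1) = M r ⊓ (M (-(r : ℤ) - 1)).comap (N ^ r) := by
  have hle : M ((r : ℤ) - 1) ≤ M r := hM (by lia)
  rw [LinearMap.ker_comp, Submodule.ker_mkQ, Submodule.comap_comp]
  constructor
  · intro h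
    have := congrArg (Submodule.map (M (r : ℤ)).subtype) h
    rw [Submodule.map_comap_subtype, Submodule.map_comap_subtype, inf_eq_right.2 hle] at this
    exact this.symm
  · intro h
    rw [h, Submodule.comap_inf, Submodule.comap_subtype_self, top_inf_eq]

lemma isMonodromyFiltration_range_iff {M : ℤ → Submodule K V} (hM : Monotone M) (r : ℕ) :
    LinearMap.range ((M (-(r : ℤ) - 1)).mkQ ∘ₗ (N ^ r) ∘ₗ (M (r : ℤ)).subtype) =
      Submodule.map (M (-(r : ℤ) - 1)).mkQ (M (-(r : ℤ))) ↔
    M (-(r : ℤ)) = (M r).map (N ^ r) ⊔ M (-(r : ℤ) - 1) := by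
  have hle : M (-(r : ℤ) - 1) ≤ M (-(r : ℤ)) := hM (by lia)
  rw [LinearMap.range_comp, LinearMap.range_comp, Submodule.range_subtype]
  constructor
  · intro h
    have := congrArg (Submodule.comap (M (-(r : ℤ) - 1)).mkQ) h
    rw [Submodule.comap_map_mkQ, Submodule.comap_map_mkQ, sup_eq_right.2 hle, sup_comm] at this
    exact this.symm
  · intro h
    conv_rhs => rw [h, Submodule.map_sup, Submodule.mkQ_map_self, sup_bot_eq]

/-- The monodromy filtration of an endomorphism is unique. -/
lemma IsMonodromyFiltration.eq {M M' : ℤ → Submodule K V}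
    (hM : IsMonodromyFiltration N M) (hM' : IsMonodromyFiltration N M') : M = M' := by
  obtain ⟨mono, ⟨a, ha⟩, ⟨b, hb⟩, -, h⟩ := hM
  obtain ⟨mono', ⟨a', ha'⟩, ⟨b', hb'⟩, -, h'⟩ := hM'
  simp only [isMonodromyFiltration_ker_iff mono, isMonodromyFiltration_range_iff mono] at h
  simp only [isMonodromyFiltration_ker_iff mono', isMonodromyFiltration_range_iff mono'] at h'
  let k₀ : ℕ := a.natAbs + a'.natAbs + b.natAbs + b'.natAbs
  have top_of_le (k : ℤ) (hk : k₀ ≤ k) : M k = M' k := by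
    rw [hb k (by lia), hb' k (by lia)]
  have bot_of_le (k : ℤ) (hk : k ≤ -k₀) : M k = M' k := by
    rw [ha k (by lia), ha' k (by lia)]
  have key (j : ℕ) : ∀ k : ℕ, k₀ ≤ k + j →
      M ((k : ℤ) - 1) = M' ((k : ℤ) - 1) ∧ M (-(k : ℤ)) = M' (-(k : ℤ)) := by
    induction j with
    | zero =>
      intro k hk
      have hbot := bot_of_le (-(k : ℤ) - 1) (by lia)
      have htop := top_of_le k (by lia)
      rw [(h k).1, (h' k).1, (h k).2, (h' k).2, hbot, htop]
      exact ⟨rfl, rfl⟩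
    | succ j ih =>
      intro k hk
      obtain ⟨h₁, h₂⟩ := ih (k + 1) (by lia)
      have htop : M k = M' k := by simpa using h₁
      have hbot : M (-(k : ℤ) - 1) = M' (-(k : ℤ) - 1) := by
        simpa [neg_add, sub_eq_add_neg, add_comm] using h₂
      rw [(h k).1, (h' k).1, (h k).2, (h' k).2, hbot, htop]
      exact ⟨rfl, rfl⟩
  funext r
  obtain ⟨k, rfl | rfl⟩ := r.eq_nat_or_neg
  · simpa using (key k₀ (k + 1) (by lia)).1
  · exact (key k₀ k (by lia)).2

end Uniqueness

section Sl2

variable {K V W : Type*} [Field K] [AddCommGroup V] [Module K V] [AddCommGroup W] [Module K W]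

/-- `N`, `H`, `E` span a representation of `sl₂` that is the sum of its integral weight spaces, with
`N` lowering and `E` raising weights by two. -/
structure IsIntegralSl2Triple (N H E : Module.End K V) : Prop where
  h_n (x : V) : H (N x) = N (H x) - (2 : K) • N x
  h_e (x : V) : H (E x) = E (H x) + (2 : K) • E x
  e_n (x : V) : E (N x) = N (E x) + H x
  iSup_eigenspace : ⨆ k : ℤ, H.eigenspace (k : K) = ⊤

/-- The sum of the eigenspaces of `H` with integral eigenvalue at most `r`. -/
def weightFiltration (H : Module.End K V) (r : ℤ) : Submodule K V :=
  ⨆ k : ℤ, ⨆ _ : k ≤ r, H.eigenspace (k : K)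

lemma eigenspace_le_weightFiltration (H : Module.End K V) {k r : ℤ} (h : k ≤ r) :
    H.eigenspace (k : K) ≤ weightFiltration H r :=
  le_iSup₂_of_le k h le_rfl

lemma weightFiltration_le_iff {H : Module.End K V} {r : ℤ} {S : Submodule K V} :
    weightFiltration H r ≤ S ↔ ∀ k ≤ r, H.eigenspace (k : K) ≤ S :=
  iSup₂_le_iff

lemma weightFiltration_mono (H : Module.End K V) : Monotone (weightFiltration H) := fun _ _ h =>
  weightFiltration_le_iff.2 fun _ hk => eigenspace_le_weightFiltration H (hk.trans h)

lemma weightFiltration_eq_sup (H : Module.End K V) (r : ℤ) :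
    weightFiltration H r = H.eigenspace (r : K) ⊔ weightFiltration H (r - 1) := by
  refine le_antisymm (weightFiltration_le_iff.2 fun k hk => ?_)
    (sup_le (eigenspace_le_weightFiltration H le_rfl) (weightFiltration_mono H (by lia)))
  obtain rfl | hk := hk.eq_or_lt
  · exact le_sup_left
  · exact (eigenspace_le_weightFiltration H (by lia)).trans le_sup_right

section CharZero

variable [CharZero K]

lemma iSupIndep_eigenspace_intCast (H : Module.End K V) :
    iSupIndep fun k : ℤ => H.eigenspace (k : K) :=
  H.eigenspaces_iSupIndep.comp Int.cast_injective

lemma disjoint_eigenspace_weightFiltration (H : Module.End K V) (r : ℤ) :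
    Disjoint (H.eigenspace (r : K)) (weightFiltration H (r - 1)) :=
  (iSupIndep_eigenspace_intCast H r).mono_right <| weightFiltration_le_iff.2 fun k hk =>
    le_iSup₂_of_le k (by lia) le_rfl

lemma exists_eigenspace_intCast_eq_bot [FiniteDimensional K V] (H : Module.End K V) :
    ∃ B : ℕ, ∀ k : ℤ, B < k.natAbs → H.eigenspace (k : K) = ⊥ := by
  have hfin := WellFoundedGT.finite_ne_bot_of_iSupIndep (iSupIndep_eigenspace_intCast H)
  obtain ⟨B, hB⟩ := (hfin.image Int.natAbs).bddAbove
  refine ⟨B, fun k hk => ?_⟩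
  by_contra h
  exact hk.not_ge (hB ⟨k, h, rfl⟩)

/-- A family of subspaces of the eigenspaces spanning everything consists of the eigenspaces. -/
lemma eigenspace_le_of_iSup_eq_top {H : Module.End K V} {U : ℤ → Submodule K V}
    (hU : ∀ k, U k ≤ H.eigenspace (k : K)) (htop : ⨆ k, U k = ⊤) (k : ℤ) :
    H.eigenspace (k : K) ≤ U k := by
  have hsup : U k ⊔ ⨆ j : ℤ, ⨆ _ : j ≠ k, H.eigenspace (j : K) = ⊤ := by
    refine top_le_iff.1 (htop.ge.trans (iSup_le fun j => ?_))
    by_cases h : j = k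
    · exact h ▸ le_sup_left
    · exact (hU j).trans (le_sup_of_le_right (le_iSup₂_of_le j h le_rfl))
  have := sup_inf_assoc_of_le (⨆ j : ℤ, ⨆ _ : j ≠ k, H.eigenspace (j : K)) (hU k)
  rw [hsup, top_inf_eq, inf_comm, (iSupIndep_eigenspace_intCast H k).eq_bot, sup_bot_eq] at this
  exact this.le

end CharZero

namespace IsIntegralSl2Triple

variable {N H E : Module.End K V}

/-- The opposite triple, in which raising and lowering operators are exchanged. -/
lemma symm (t : IsIntegralSl2Triple N H E) : IsIntegralSl2Triple E (-H) N where
  h_n x := by simp [t.h_e]; abel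
  h_e x := by simp [t.h_n]; abel
  e_n x := by simp [t.e_n]
  iSup_eigenspace := by
    rw [← t.iSup_eigenspace]
    refine (Equiv.neg ℤ).iSup_congr fun k => ?_
    ext x
    simp [neg_eq_iff_eq_neg]

lemma mapsTo_n (t : IsIntegralSl2Triple N H E) {k : ℤ} {x : V} (hx : x ∈ H.eigenspace (k : K)) :
    N x ∈ H.eigenspace ((k - 2 : ℤ) : K) := by
  rw [Module.End.mem_eigenspace_iff] at hx ⊢
  rw [t.h_n, hx, map_smul, ← sub_smul]
  push_cast
  rfl

lemma mapsTo_e (t : IsIntegralSl2Triple N H E) {k : ℤ} {x : V} (hx : x ∈ H.eigenspace (k : K)) :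
    E x ∈ H.eigenspace ((k + 2 : ℤ) : K) := by
  rw [Module.End.mem_eigenspace_iff] at hx ⊢
  rw [t.h_e, hx, map_smul, ← add_smul]
  push_cast
  rfl

lemma mapsTo_n_pow (t : IsIntegralSl2Triple N H E) {k : ℤ} {x : V}
    (hx : x ∈ H.eigenspace (k : K)) (n : ℕ) :
    (N ^ n) x ∈ H.eigenspace ((k - 2 * n : ℤ) : K) := by
  induction n with
  | zero => simpa using hx
  | succ n ih =>
    rw [pow_succ', Module.End.mul_apply]
    convert t.mapsTo_n ih using 3
    push_cast
    ring

lemma mapsTo_e_pow (t : IsIntegralSl2Triple N H E) {k : ℤ} {x : V}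
    (hx : x ∈ H.eigenspace (k : K)) (n : ℕ) :
    (E ^ n) x ∈ H.eigenspace ((k + 2 * n : ℤ) : K) := by
  induction n with
  | zero => simpa using hx
  | succ n ih =>
    rw [pow_succ', Module.End.mul_apply]
    convert t.mapsTo_e ih using 3
    push_cast
    ring

lemma e_n_pow (t : IsIntegralSl2Triple N H E) {k : ℤ} {x : V}
    (hx : x ∈ H.eigenspace (k : K)) (n : ℕ) :
    E ((N ^ (n + 1)) x) =
      (N ^ (n + 1)) (E x) + (((n + 1) * (k - n) : ℤ) : K) • (N ^ n) x := by
  induction n with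
  | zero =>
    rw [Module.End.mem_eigenspace_iff] at hx
    simp [t.e_n, hx]
  | succ n ih =>
    have h := t.mapsTo_n_pow hx (n + 1)
    rw [Module.End.mem_eigenspace_iff] at h
    rw [pow_succ' N (n + 1), Module.End.mul_apply, t.e_n, ih, h, map_add, map_smul,
      ← Module.End.mul_apply N (N ^ n), ← pow_succ', add_assoc, ← add_smul,
      Module.End.mul_apply]
    congr 2
    push_cast
    ring

variable [CharZero K] [FiniteDimensional K V]

/-- On nonnegative weight spaces `N ∘ E` has no negative integral eigenvalue. -/
lemma eq_zero_of_n_e_eq_neg_smul (t : IsIntegralSl2Triple N H E) {k c : ℤ} (hk : 0 ≤ k)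
    (hc : 0 < c) {x : V} (hx : x ∈ H.eigenspace (k : K)) (h : N (E x) = -(c : K) • x) :
    x = 0 := by
  obtain ⟨B, hB⟩ := exists_eigenspace_intCast_eq_bot H
  obtain ⟨d, hd⟩ : ∃ d : ℕ, (B : ℤ) + 1 ≤ k + d := ⟨B + 1, by lia⟩
  induction d generalizing k c x with
  | zero =>
    rw [hB k (by lia)] at hx
    simpa using hx
  | succ d ih =>
    have hEx := t.mapsTo_e hx
    have hE : E x = 0 := by
      refine ih (k := k + 2) (c := c + (k + 2)) (by lia) (by lia) hEx ?_ (by lia)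
      have h' := t.e_n (E x)
      rw [h, map_smul, Module.End.mem_eigenspace_iff.1 hEx] at h'
      rw [← sub_eq_iff_eq_add.2 h', ← sub_smul]
      congr 1
      push_cast
      ring
    have : (-(c : K)) ≠ 0 := neg_ne_zero.2 (Int.cast_ne_zero.2 hc.ne')
    rw [hE, map_zero] at h
    exact (smul_eq_zero.1 h.symm).resolve_left this

lemma eq_zero_of_n_pow_eq_zero (t : IsIntegralSl2Triple N H E) {k : ℤ} {n : ℕ} (hn : n ≤ k)
    {x : V} (hx : x ∈ H.eigenspace (k : K)) (h : (N ^ n) x = 0) : x = 0 := by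
  induction n generalizing x with
  | zero => simpa using h
  | succ n ih =>
    refine t.eq_zero_of_n_e_eq_neg_smul (c := (n + 1) * (k - n)) (by lia)
      (mul_pos (by lia) (by lia)) hx ?_
    rw [neg_smul, eq_neg_iff_add_eq_zero]
    refine ih (by lia) (Submodule.add_mem _ ?_ (Submodule.smul_mem _ _ hx)) ?_
    · simpa using t.mapsTo_n (t.mapsTo_e hx)
    · rw [map_add, map_smul, ← Module.End.mul_apply (N ^ n) N, ← pow_succ, ← t.e_n_pow hx, h,
        map_zero]

lemma eq_zero_of_e_pow_eq_zero (t : IsIntegralSl2Triple N H E) {k : ℤ} {n : ℕ} (hn : n ≤ k)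
    {x : V} (hx : x ∈ H.eigenspace ((-k : ℤ) : K)) (h : (E ^ n) x = 0) : x = 0 := by
  refine t.symm.eq_zero_of_n_pow_eq_zero hn ?_ h
  rw [Module.End.mem_eigenspace_iff] at hx ⊢
  simp [hx]

lemma eigenspace_neg_le_map_n_pow (t : IsIntegralSl2Triple N H E) (r : ℕ) :
    H.eigenspace ((-r : ℤ) : K) ≤ (H.eigenspace ((r : ℤ) : K)).map (N ^ r) := by
  have hE {x : V} (hx : x ∈ H.eigenspace ((-r : ℤ) : K)) :
      (E ^ r) x ∈ H.eigenspace ((r : ℤ) : K) := by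
    convert t.mapsTo_e_pow hx r using 3
    ring
  have hN {x : V} (hx : x ∈ H.eigenspace ((r : ℤ) : K)) :
      (N ^ r) x ∈ H.eigenspace ((-r : ℤ) : K) := by
    convert t.mapsTo_n_pow hx r using 3
    ring
  let f := (N ^ r * E ^ r).restrict fun x (hx : x ∈ H.eigenspace ((-r : ℤ) : K)) => hN (hE hx)
  have hf : Function.Injective f := by
    refine (injective_iff_map_eq_zero f).2 fun x hx => ?_
    have hx' : (N ^ r) ((E ^ r) (x : V)) = 0 := congrArg Subtype.val hx
    exact Subtype.ext <| t.eq_zero_of_e_pow_eq_zero le_rfl x.2 <|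
      t.eq_zero_of_n_pow_eq_zero le_rfl (hE x.2) hx'
  intro y hy
  obtain ⟨x, hx⟩ := LinearMap.injective_iff_surjective.1 hf ⟨y, hy⟩
  exact ⟨(E ^ r) x, hE x.2, congrArg Subtype.val hx⟩

/-- The weight filtration of an `sl₂`-triple is the monodromy filtration of the lowering
operator. -/
lemma isMonodromyFiltration (t : IsIntegralSl2Triple N H E) :
    IsMonodromyFiltration N (weightFiltration H) := by
  have mono := weightFiltration_mono H
  obtain ⟨B, hB⟩ := exists_eigenspace_intCast_eq_bot H
  have hN (r : ℤ) (n : ℕ) :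
      (weightFiltration H r).map (N ^ n) ≤ weightFiltration H (r - 2 * n) := by
    refine Submodule.map_le_iff_le_comap.2 (weightFiltration_le_iff.2 fun k hk x hx => ?_)
    exact eigenspace_le_weightFiltration H (by lia) (t.mapsTo_n_pow hx n)
  refine ⟨mono, ⟨-B - 1, fun r hr => ?_⟩, ⟨B, fun r hr => ?_⟩, fun r => ?_, fun r => ?_⟩
  · exact eq_bot_iff.2 (weightFiltration_le_iff.2 fun k hk => (hB k (by lia)).le)
  · refine eq_top_iff.2 (t.iSup_eigenspace.ge.trans (iSup_le fun k => ?_))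
    by_cases hk : k ≤ r
    · exact eigenspace_le_weightFiltration H hk
    · exact (hB k (by lia)).le.trans bot_le
  · simpa using hN r 1
  rw [isMonodromyFiltration_ker_iff mono, isMonodromyFiltration_range_iff mono]
  have hN₁ : (weightFiltration H ((r : ℤ) - 1)).map (N ^ r) ≤ weightFiltration H (-r - 1) :=
    (hN _ r).trans (mono (by lia))
  constructor
  · refine le_antisymm (le_inf (mono (by lia)) (Submodule.map_le_iff_le_comap.1 hN₁)) ?_
    rintro x ⟨hx, hNx⟩
    rw [SetLike.mem_coe, weightFiltration_eq_sup] at hx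
    obtain ⟨y, hy, z, hz, rfl⟩ := Submodule.mem_sup.1 hx
    have hNy : (N ^ r) y ∈ weightFiltration H (-r - 1) := by
      rw [SetLike.mem_coe, Submodule.mem_comap, map_add] at hNx
      exact (Submodule.add_mem_iff_left _ (hN₁ ⟨z, hz, rfl⟩)).1 hNx
    have hNy' : (N ^ r) y ∈ H.eigenspace ((-r : ℤ) : K) := by
      convert t.mapsTo_n_pow hy r using 3
      ring
    have h0 := Submodule.disjoint_def.1 (disjoint_eigenspace_weightFiltration H (-r)) _ hNy' hNy
    rw [t.eq_zero_of_n_pow_eq_zero le_rfl hy h0, zero_add]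
    exact hz
  · refine le_antisymm ?_ (sup_le ((hN r r).trans (mono (by lia))) (mono (by lia)))
    rw [weightFiltration_eq_sup H (-r)]
    refine sup_le_sup_right ?_ _
    exact (t.eigenspace_neg_le_map_n_pow r).trans
      (Submodule.map_mono (eigenspace_le_weightFiltration H le_rfl))

end IsIntegralSl2Triple

section TensorProduct

variable {N₁ H₁ E₁ : Module.End K V} {N₂ H₂ E₂ : Module.End K W}

lemma map₂_eigenspace_le (k l : ℤ) :
    Submodule.map₂ (TensorProduct.mk K V W) (H₁.eigenspace (k : K)) (H₂.eigenspace (l : K)) ≤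
      Module.End.eigenspace (TensorProduct.map H₁ .id + TensorProduct.map .id H₂)
        ((k + l : ℤ) : K) := by
  refine Submodule.map₂_le.2 fun x hx y hy => ?_
  rw [Module.End.mem_eigenspace_iff] at hx hy ⊢
  simp [hx, hy, TensorProduct.smul_tmul', TensorProduct.tmul_smul, add_smul]

lemma iSup_map₂_eigenspace_eq_top (h₁ : ⨆ k : ℤ, H₁.eigenspace (k : K) = ⊤)
    (h₂ : ⨆ k : ℤ, H₂.eigenspace (k : K) = ⊤) :
    ⨆ k : ℤ, ⨆ i : ℤ, Submodule.map₂ (TensorProduct.mk K V W)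
      (H₁.eigenspace (i : K)) (H₂.eigenspace ((k - i : ℤ) : K)) = ⊤ := by
  rw [← top_le_iff, ← TensorProduct.map₂_mk_top_top_eq_top, ← h₁, ← h₂,
    Submodule.map₂_iSup_left]
  refine iSup_le fun i => ?_
  rw [Submodule.map₂_iSup_right]
  exact iSup_le fun j => le_iSup₂_of_le (i + j) i (by rw [add_sub_cancel_left])

lemma IsIntegralSl2Triple.tensorProduct (t₁ : IsIntegralSl2Triple N₁ H₁ E₁)
    (t₂ : IsIntegralSl2Triple N₂ H₂ E₂) :
    IsIntegralSl2Triple (TensorProduct.map N₁ .id + TensorProduct.map .id N₂)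
      (TensorProduct.map H₁ .id + TensorProduct.map .id H₂)
      (TensorProduct.map E₁ .id + TensorProduct.map .id E₂) where
  h_n z := by
    induction z with
    | zero => simp
    | add x y hx hy => simp only [map_add, hx, hy, smul_add]; abel
    | tmul x y =>
      simp [t₁.h_n, t₂.h_n, TensorProduct.sub_tmul, TensorProduct.tmul_sub,
        TensorProduct.smul_tmul', TensorProduct.tmul_smul]
      abel
  h_e z := by
    induction z with
    | zero => simp
    | add x y hx hy => simp only [map_add, hx, hy, smul_add]; abel
    | tmul x y =>
      simp [t₁.h_e, t₂.h_e, TensorProduct.add_tmul, TensorProduct.tmul_add,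
        TensorProduct.smul_tmul', TensorProduct.tmul_smul]
      abel
  e_n z := by
    induction z with
    | zero => simp
    | add x y hx hy => simp only [map_add, hx, hy]; abel
    | tmul x y =>
      simp [t₁.e_n, t₂.e_n, TensorProduct.add_tmul, TensorProduct.tmul_add]
      abel
  iSup_eigenspace := by
    rw [← top_le_iff, ← iSup_map₂_eigenspace_eq_top t₁.iSup_eigenspace t₂.iSup_eigenspace]
    refine iSup₂_le fun k i => le_iSup_of_le k ?_
    simpa only [add_sub_cancel] using map₂_eigenspace_le (H₁ := H₁) (H₂ := H₂) i (k - i)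

lemma weightFiltration_tensorProduct [CharZero K] (h₁ : ⨆ k : ℤ, H₁.eigenspace (k : K) = ⊤)
    (h₂ : ⨆ k : ℤ, H₂.eigenspace (k : K) = ⊤) (r : ℤ) :
    weightFiltration (TensorProduct.map H₁ .id + TensorProduct.map .id H₂) r =
      ⨆ i : ℤ, Submodule.map₂ (TensorProduct.mk K V W)
        (weightFiltration H₁ i) (weightFiltration H₂ (r - i)) := by
  apply le_antisymm
  · refine weightFiltration_le_iff.2 fun k hk => ?_
    refine (eigenspace_le_of_iSup_eq_top (fun k => iSup_le fun i => ?_)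
      (iSup_map₂_eigenspace_eq_top h₁ h₂) k).trans (iSup_mono fun i => ?_)
    · simpa only [add_sub_cancel] using map₂_eigenspace_le (H₁ := H₁) (H₂ := H₂) i (k - i)
    · exact Submodule.map₂_le_map₂ (eigenspace_le_weightFiltration H₁ le_rfl)
        (eigenspace_le_weightFiltration H₂ (by lia))
  · refine iSup_le fun i => ?_
    simp only [weightFiltration, Submodule.map₂_iSup_left, Submodule.map₂_iSup_right, iSup_le_iff]
    intro k hk l hl
    exact (map₂_eigenspace_le l k).trans (eigenspace_le_weightFiltration _ (by lia))

end TensorProduct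

section Existence

lemma LinearMap.exists_comp_eq_comp_of_surjective {f : V →ₗ[K] W} (hf : Function.Surjective f)
    (T : Module.End K V) (hT : ∀ x, f x = 0 → f (T x) = 0) :
    ∃ T' : Module.End K W, ∀ x, T' (f x) = f (T x) := by
  obtain ⟨s, hs⟩ := f.exists_rightInverse_of_surjective (LinearMap.range_eq_top.2 hf)
  refine ⟨f ∘ₗ T ∘ₗ s, fun x => sub_eq_zero.1 ?_⟩
  simp only [LinearMap.comp_apply, ← map_sub]
  apply hT
  rw [map_sub, ← LinearMap.comp_apply, hs, LinearMap.id_apply, sub_self]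

lemma IsIntegralSl2Triple.exists_of_surjective {N H E : Module.End K V}
    (t : IsIntegralSl2Triple N H E) {f : V →ₗ[K] W} (hf : Function.Surjective f)
    (hH : ∀ x, f x = 0 → f (H x) = 0) (hE : ∀ x, f x = 0 → f (E x) = 0)
    {N' : Module.End K W} (hN : ∀ x, N' (f x) = f (N x)) :
    ∃ H' E', IsIntegralSl2Triple N' H' E' := by
  obtain ⟨H', hH'⟩ := LinearMap.exists_comp_eq_comp_of_surjective hf H hH
  obtain ⟨E', hE'⟩ := LinearMap.exists_comp_eq_comp_of_surjective hf E hE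
  refine ⟨H', E', hf.forall.2 fun x => ?_, hf.forall.2 fun x => ?_, hf.forall.2 fun x => ?_, ?_⟩
  · simp [hN, hH', t.h_n]
  · simp [hE', hH', t.h_e]
  · simp [hN, hH', hE', t.e_n]
  · rw [← top_le_iff, ← LinearMap.range_eq_top.2 hf, LinearMap.range_eq_map,
      ← t.iSup_eigenspace, Submodule.map_iSup]
    refine iSup_mono fun k => ?_
    rintro _ ⟨x, hx, rfl⟩
    rw [SetLike.mem_coe, Module.End.mem_eigenspace_iff] at hx
    rw [Module.End.mem_eigenspace_iff, hH', hx, map_smul]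

lemma IsIntegralSl2Triple.directSum {ι : Type*} {V : ι → Type*} [∀ i, AddCommGroup (V i)]
    [∀ i, Module K (V i)] {N H E : ∀ i, Module.End K (V i)}
    (t : ∀ i, IsIntegralSl2Triple (N i) (H i) (E i)) :
    IsIntegralSl2Triple (DirectSum.lmap N) (DirectSum.lmap H) (DirectSum.lmap E) where
  h_n x := by ext i; simp [(t i).h_n, DirectSum.smul_apply]
  h_e x := by ext i; simp [(t i).h_e, DirectSum.smul_apply]
  e_n x := by ext i; simp [(t i).e_n]
  iSup_eigenspace := by
    classical
    refine top_le_iff.1 fun x _ => ?_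
    induction x using DirectSum.induction_on with
    | zero => exact Submodule.zero_mem _
    | add x y hx hy => exact Submodule.add_mem _ (hx trivial) (hy trivial)
    | of i x =>
      have hle : (⊤ : Submodule K (V i)) ≤ (⨆ k : ℤ,
          Module.End.eigenspace (DirectSum.lmap H) (k : K)).comap (DirectSum.lof K ι V i) := by
        rw [← (t i).iSup_eigenspace]
        refine iSup_le fun k y hy => Submodule.mem_iSup_of_mem k ?_
        rw [Module.End.mem_eigenspace_iff] at hy ⊢
        rw [DirectSum.lmap_lof, hy, map_smul]
      exact hle (Submodule.mem_top (x := x))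

open Polynomial in
/-- A Jordan block of size `n` is a quotient of this triple on polynomials. -/
lemma isIntegralSl2Triple_polynomial (n : ℕ) :
    IsIntegralSl2Triple (LinearMap.mulLeft K (X : K[X]))
      (((n : K) - 1) • LinearMap.id - (2 : K) • LinearMap.mulLeft K X ∘ₗ derivative)
      (((n : K) - 1) • derivative - LinearMap.mulLeft K X ∘ₗ derivative ∘ₗ derivative) where
  h_n p := by simp [smul_eq_C_mul]; ring
  h_e p := by simp [smul_eq_C_mul]; ring
  e_n p := by simp [smul_eq_C_mul, C_ofNat]; ring
  iSup_eigenspace := by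
    refine top_le_iff.1 fun p _ => ?_
    induction p using Polynomial.induction_on' with
    | add p q hp hq => exact Submodule.add_mem _ (hp trivial) (hq trivial)
    | monomial i a =>
      refine Submodule.mem_iSup_of_mem ((n : ℤ) - 1 - 2 * i) ?_
      rw [Module.End.mem_eigenspace_iff]
      cases i with
      | zero => simp
      | succ i =>
        simp [smul_monomial, X_mul_monomial, ← map_sub]
        congr 1
        ring

open Polynomial in
lemma exists_isIntegralSl2Triple_of_ker_eq_span_X_pow [Module K[X] V] [IsScalarTower K K[X] V]
    {n : ℕ} {f : K[X] →ₗ[K[X]] V} (hf : Function.Surjective f)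
    (hker : LinearMap.ker f = K[X] ∙ (X : K[X]) ^ n) :
    ∃ H E, IsIntegralSl2Triple (Algebra.lsmul K K V (X : K[X])) H E := by
  have hf₀ (p : K[X]) : f p = 0 ↔ X ^ n ∣ p := by
    rw [← LinearMap.mem_ker, hker, Ideal.submodule_span_eq, Ideal.mem_span_singleton]
  obtain ⟨P, hP⟩ : ∃ P : K[X], P = X ^ n := ⟨_, rfl⟩
  have h₁ : X * derivative P = (n : K[X]) * P := by
    rw [hP, derivative_X_pow]
    cases n
    · simp
    · simp [pow_succ']
      ring
  have h₂ : X * derivative (derivative P) = ((n : K[X]) - 1) * derivative P := by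
    have h := congrArg derivative h₁
    simp only [derivative_mul, derivative_X, derivative_natCast] at h
    linear_combination h
  simp only [← hP] at hf₀
  refine (isIntegralSl2Triple_polynomial n).exists_of_surjective (f := f.restrictScalars K)
    hf ?_ ?_ fun p => (f.map_smul X p).symm
  · intro p hp
    obtain ⟨q, rfl⟩ := (hf₀ p).1 hp
    refine (hf₀ _).2 ⟨((n : K[X]) - 1) * q - 2 * ((n : K[X]) * q + X * derivative q), ?_⟩
    simp [smul_eq_C_mul, C_ofNat]
    linear_combination (-2 * q) * h₁
  · intro p hp
    obtain ⟨q, rfl⟩ := (hf₀ p).1 hp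
    refine (hf₀ _).2 ⟨-((n : K[X]) + 1) * derivative q - X * derivative (derivative q), ?_⟩
    simp [smul_eq_C_mul]
    linear_combination (-q) * h₂ - 2 * derivative q * h₁

open Polynomial in
/-- Every nilpotent endomorphism is part of an integral `sl₂`-triple. -/
lemma exists_isIntegralSl2Triple [FiniteDimensional K V] {N : Module.End K V}
    (hN : IsNilpotent N) : ∃ H E, IsIntegralSl2Triple N H E := by
  obtain ⟨m, hm⟩ := hN
  have htors : Module.IsTorsion' (Module.AEval' N) (Submonoid.powers (X : K[X])) := by
    intro x
    refine ⟨⟨X ^ m, m, rfl⟩, ?_⟩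
    obtain ⟨x, rfl⟩ := (Module.AEval'.of N).surjective x
    change (X : K[X]) ^ m • Module.AEval'.of N x = 0
    rw [Module.AEval'.X_pow_smul_of, hm, zero_smul, map_zero]
  obtain ⟨d, k, ⟨e⟩⟩ := Module.torsion_by_prime_power_decomposition Polynomial.irreducible_X htors
  have hblock (i : Fin d) := exists_isIntegralSl2Triple_of_ker_eq_span_X_pow (n := k i)
    (Submodule.mkQ_surjective (K[X] ∙ (X : K[X]) ^ k i)) (Submodule.ker_mkQ _)
  choose H E t using hblock
  let e' := (e.symm.restrictScalars K).trans (Module.AEval'.of N).symm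
  refine (IsIntegralSl2Triple.directSum t).exists_of_surjective (f := e'.toLinearMap)
    e'.surjective ?_ ?_ fun x => ?_
  · simp +contextual
  · simp +contextual
  · have hx : DirectSum.lmap
        (fun i => Algebra.lsmul K K (K[X] ⧸ K[X] ∙ (X : K[X]) ^ k i) (X : K[X])) x =
          (X : K[X]) • x := by
      ext i
      rfl
    rw [hx]
    change N ((Module.AEval'.of N).symm (e.symm x)) =
      (Module.AEval'.of N).symm (e.symm ((X : K[X]) • x))
    rw [map_smul, Module.AEval'.of_symm_X_smul]

end Existence

end Sl2

/-- The monodromy filtration of `N = N₁ ⊗ id + id ⊗ N₂` on `V ⊗ W` is the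
convolution of the monodromy filtrations of `N₁` and `N₂`:
`M_r(V ⊗ W, N) = Σ_{i+j=r} M_i(V, N₁) ⊗ M_j(W, N₂)`; moreover `N` is
nilpotent. -/
theorem stmt_16 (K V W : Type*) [Field K] [CharZero K]
    [AddCommGroup V] [Module K V] [AddCommGroup W] [Module K W]
    [FiniteDimensional K V] [FiniteDimensional K W]
    (N₁ : V →ₗ[K] V) (N₂ : W →ₗ[K] W)
    (h₁ : IsNilpotent N₁) (h₂ : IsNilpotent N₂)
    (MV : ℤ → Submodule K V) (MW : ℤ → Submodule K W)
    (M : ℤ → Submodule K (V ⊗[K] W))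
    (hMV : IsMonodromyFiltration N₁ MV) (hMW : IsMonodromyFiltration N₂ MW)
    (hM : IsMonodromyFiltration
      (TensorProduct.map N₁ LinearMap.id + TensorProduct.map LinearMap.id N₂) M) :
    IsNilpotent (TensorProduct.map N₁ LinearMap.id + TensorProduct.map LinearMap.id N₂) ∧
    ∀ r : ℤ, M r = ⨆ i : ℤ,
      LinearMap.range (TensorProduct.mapIncl (MV i) (MW (r - i))) := by
  obtain ⟨H₁, E₁, t₁⟩ := exists_isIntegralSl2Triple h₁
  obtain ⟨H₂, E₂, t₂⟩ := exists_isIntegralSl2Triple h₂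
  refine ⟨?_, fun r => ?_⟩
  · refine Commute.isNilpotent_add ?_ (h₁.map (Module.End.rTensorAlgHom K V W))
      (h₂.map (Module.End.lTensorAlgHom K W V))
    exact TensorProduct.ext' fun x y => by simp
  · rw [hM.eq (t₁.tensorProduct t₂).isMonodromyFiltration, hMV.eq t₁.isMonodromyFiltration,
      hMW.eq t₂.isMonodromyFiltration,
      weightFiltration_tensorProduct t₁.iSup_eigenspace t₂.iSup_eigenspace]
    simp only [TensorProduct.range_mapIncl]
end
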